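/- If Δ is Eulerian and d is even (i.e. Δ has odd dimension d−1), then Δ has Property E, i.e. e_k(Δ) = (−1)^{d−k} f_{k−1}(Δ) for all 0 ≤ k ≤ d. -/

import Mathlib

/-- `f_{i-1}(Γ)`: the number of faces of `Γ` of cardinality `i`. -/
def faceCount (n : ℕ) (Γ : Finset (Finset (Fin n))) (i : ℕ) : ℕ :=
  (Γ.filter fun σ => σ.card = i).card

/-- The `e`-vector: `e_k(Δ) = ∑_{i=k}^{d} (−1)^{i−k} (i choose k) f_{i−1}(Δ)`. -/
def eVec (n d : ℕ) (Δ : Finset (Finset (Fin n))) (k : ℕ) : ℤ :=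
  ∑ i ∈ Finset.Icc k d, (-1) ^ (i - k) * (i.choose k : ℤ) * (faceCount n Δ i : ℤ)

/-- The reduced Euler characteristic `χ̃(Γ) = ∑_{i ≥ 0} (−1)^i f_i(Γ)`
(here `f_i` counts faces of cardinality `i+1`, which is at most `n`). -/
def redEuler (n : ℕ) (Γ : Finset (Finset (Fin n))) : ℤ :=
  ∑ i ∈ Finset.range n, (-1) ^ i * (faceCount n Γ (i + 1) : ℤ)

/-- The link of a face `σ`: `Lk σ = {τ ∈ Δ : τ ∩ σ = ∅ and τ ∪ σ ∈ Δ}`. -/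
def linkFace (n : ℕ) (Δ : Finset (Finset (Fin n))) (σ : Finset (Fin n)) :
    Finset (Finset (Fin n)) :=
  Δ.filter fun τ => τ ∩ σ = ∅ ∧ τ ∪ σ ∈ Δ

theorem sum_mul_faceCount (n : ℕ) (Γ : Finset (Finset (Fin n))) (s : Finset ℕ) (g : ℕ → ℤ) :
    ∑ i ∈ s, g i * (faceCount n Γ i : ℤ) = ∑ τ ∈ Γ, if τ.card ∈ s then g τ.card else 0 := by
  have h : ∀ i ∈ s, g i * (faceCount n Γ i : ℤ) = ∑ τ ∈ Γ, if τ.card = i then g i else 0 := by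
    intro i _
    rw [← Finset.sum_filter, Finset.sum_const, nsmul_eq_mul, mul_comm, faceCount]
  rw [Finset.sum_congr rfl h, Finset.sum_comm]
  exact Finset.sum_congr rfl fun τ _ => Finset.sum_ite_eq s τ.card g

theorem one_sub_redEuler (n : ℕ) (Γ : Finset (Finset (Fin n))) (hempty : ∅ ∈ Γ) :
    1 - redEuler n Γ = ∑ τ ∈ Γ, (-1 : ℤ) ^ τ.card := by
  have h := sum_mul_faceCount n Γ (Finset.range (n + 1)) fun i => (-1) ^ i
  have h0 : faceCount n Γ 0 = 1 := by
    rw [faceCount, Finset.card_eq_one]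
    refine ⟨∅, ?_⟩
    ext σ
    simp only [Finset.mem_filter, Finset.card_eq_zero, Finset.mem_singleton]
    exact ⟨fun h => h.2, fun h => ⟨h ▸ hempty, h⟩⟩
  have hcard : ∀ τ ∈ Γ, (if τ.card ∈ Finset.range (n + 1) then (-1 : ℤ) ^ τ.card else 0)
      = (-1) ^ τ.card := by
    intro τ _
    have := Finset.card_le_univ τ
    rw [Fintype.card_fin] at this
    rw [if_pos (Finset.mem_range.2 (by omega))]
  rw [Finset.sum_congr rfl hcard] at h
  rw [← h, Finset.sum_range_succ', h0, redEuler]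
  simp only [pow_succ, mul_neg, mul_one, neg_mul, Finset.sum_neg_distrib]
  push_cast
  ring

theorem eVec_eq_sum_faces (n d : ℕ) (Δ : Finset (Finset (Fin n)))
    (hdim : ∀ σ ∈ Δ, σ.card ≤ d) (k : ℕ) :
    eVec n d Δ k = (-1) ^ k * ∑ τ ∈ Δ, (-1) ^ τ.card * (τ.card.choose k : ℤ) := by
  rw [eVec, sum_mul_faceCount n Δ _ fun i => (-1) ^ (i - k) * (i.choose k : ℤ), Finset.mul_sum]
  refine Finset.sum_congr rfl fun τ hτ => ?_
  by_cases hk : k ≤ τ.card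
  · rw [if_pos (Finset.mem_Icc.2 ⟨hk, hdim τ hτ⟩)]
    obtain ⟨m, hm⟩ := Nat.exists_eq_add_of_le hk
    rw [hm, Nat.add_sub_cancel_left, pow_add, ← mul_assoc, ← mul_assoc, ← mul_pow]
    simp
  · rw [if_neg (by simp [hk]), Nat.choose_eq_zero_of_lt (not_le.1 hk)]
    simp

theorem sum_linkFace (n : ℕ) (Δ : Finset (Finset (Fin n)))
    (hdown : ∀ σ ∈ Δ, ∀ τ ⊆ σ, τ ∈ Δ) (σ : Finset (Fin n)) :
    ∑ τ ∈ linkFace n Δ σ, (-1 : ℤ) ^ τ.card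
      = (-1) ^ σ.card * ∑ ρ ∈ Δ with σ ⊆ ρ, (-1) ^ ρ.card := by
  rw [Finset.mul_sum]
  refine Finset.sum_bij' (fun τ _ => τ ∪ σ) (fun ρ _ => ρ \ σ) ?_ ?_ ?_ ?_ ?_
  · intro τ hτ
    simp only [linkFace, Finset.mem_filter] at hτ
    exact Finset.mem_filter.2 ⟨hτ.2.2, Finset.subset_union_right⟩
  · intro ρ hρ
    rw [Finset.mem_filter] at hρ
    refine Finset.mem_filter.2 ⟨hdown ρ hρ.1 _ Finset.sdiff_subset, ?_, ?_⟩
    · exact Finset.sdiff_inter_self _ _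
    · rw [Finset.sdiff_union_of_subset hρ.2]
      exact hρ.1
  · intro τ hτ
    simp only [linkFace, Finset.mem_filter] at hτ
    exact Finset.union_sdiff_cancel_right (Finset.disjoint_iff_inter_eq_empty.2 hτ.2.1)
  · intro ρ hρ
    rw [Finset.mem_filter] at hρ
    exact Finset.sdiff_union_of_subset hρ.2
  · intro τ hτ
    simp only [linkFace, Finset.mem_filter] at hτ
    rw [Finset.card_union_of_disjoint (Finset.disjoint_iff_inter_eq_empty.2 hτ.2.1), pow_add,
      mul_left_comm, ← mul_pow]
    simp

/-- In an Eulerian complex the signed number of faces above a nonempty face is `(-1) ^ d`. -/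
theorem sum_faces_above (n d : ℕ) (Δ : Finset (Finset (Fin n))) (hempty : ∅ ∈ Δ)
    (hdown : ∀ σ ∈ Δ, ∀ τ ⊆ σ, τ ∈ Δ)
    (heuler : ∀ σ ∈ Δ, σ ≠ ∅ →
      redEuler n (linkFace n Δ σ) = 1 + (Int.negOnePow ((d : ℤ) - 1 - σ.card) : ℤ))
    (σ : Finset (Fin n)) (hσ : σ ∈ Δ) (hne : σ ≠ ∅) :
    ∑ ρ ∈ Δ with σ ⊆ ρ, (-1 : ℤ) ^ ρ.card = (-1) ^ d := by
  have h := one_sub_redEuler n (linkFace n Δ σ) (by simp [linkFace, hempty, hσ])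
  have hsign : (Int.negOnePow ((d : ℤ) - 1 - σ.card) : ℤ) = -((-1) ^ d * (-1) ^ σ.card) := by
    rw [Int.negOnePow_sub, Int.negOnePow_sub, Int.negOnePow_one]
    simp [Int.negOnePow_def]
  rw [sum_linkFace n Δ hdown, heuler σ hσ hne, hsign] at h
  have hsq : (-1 : ℤ) ^ σ.card * (-1) ^ σ.card = 1 := by simp [← mul_pow]
  linear_combination (-(-1) ^ σ.card) * h + ((-1) ^ d - ∑ ρ ∈ Δ with σ ⊆ ρ, (-1) ^ ρ.card) * hsq

/-- The signed number of faces of an odd-dimensional Eulerian complex is `1`. -/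
theorem sum_faces_eq_one (n d : ℕ) (Δ : Finset (Finset (Fin n))) (hempty : ∅ ∈ Δ)
    (hdown : ∀ σ ∈ Δ, ∀ τ ⊆ σ, τ ∈ Δ) (heven : Even d)
    (habove : ∀ σ ∈ Δ, σ ≠ ∅ → ∑ ρ ∈ Δ with σ ⊆ ρ, (-1 : ℤ) ^ ρ.card = (-1) ^ d) :
    ∑ τ ∈ Δ, (-1 : ℤ) ^ τ.card = 1 := by
  have hbelow : ∀ τ ∈ Δ, ∑ σ ∈ Δ with σ ⊆ τ, (-1 : ℤ) ^ σ.card = if τ = ∅ then 1 else 0 := by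
    intro τ hτ
    rw [← Finset.sum_powerset_neg_one_pow_card]
    refine Finset.sum_congr ?_ fun _ _ => rfl
    ext σ
    simp only [Finset.mem_filter, Finset.mem_powerset]
    exact ⟨fun h => h.2, fun h => ⟨hdown τ hτ σ h, h⟩⟩
  have hswap : ∑ σ ∈ Δ, (-1 : ℤ) ^ σ.card * ∑ ρ ∈ Δ with σ ⊆ ρ, (-1 : ℤ) ^ ρ.card = 1 := by
    calc _ = ∑ τ ∈ Δ, (-1 : ℤ) ^ τ.card * ∑ σ ∈ Δ with σ ⊆ τ, (-1 : ℤ) ^ σ.card := by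
          simp only [Finset.sum_filter, Finset.mul_sum, mul_ite, mul_zero]
          rw [Finset.sum_comm]
          simp only [mul_comm]
      _ = 1 := by
          rw [Finset.sum_congr rfl fun τ hτ => by rw [hbelow τ hτ]]
          simp [hempty]
  rw [← Finset.add_sum_erase Δ _ hempty] at hswap ⊢
  have herase : ∀ σ ∈ Δ.erase ∅, (-1 : ℤ) ^ σ.card * ∑ ρ ∈ Δ with σ ⊆ ρ, (-1 : ℤ) ^ ρ.card
      = (-1) ^ σ.card := by
    intro σ hσ
    rw [Finset.mem_erase] at hσ
    rw [habove σ hσ.2 hσ.1, heven.neg_one_pow, mul_one]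
  rw [Finset.sum_congr rfl herase] at hswap
  simp only [Finset.empty_subset, Finset.filter_true, Finset.card_empty, pow_zero, one_mul]
    at hswap ⊢
  rw [← Finset.add_sum_erase Δ _ hempty] at hswap
  simp only [Finset.card_empty, pow_zero] at hswap
  linarith

theorem sum_card_choose (n : ℕ) (Δ : Finset (Finset (Fin n)))
    (hdown : ∀ σ ∈ Δ, ∀ τ ⊆ σ, τ ∈ Δ) (k : ℕ) :
    ∑ τ ∈ Δ, (-1 : ℤ) ^ τ.card * (τ.card.choose k : ℤ)
      = ∑ σ ∈ Δ with σ.card = k, ∑ ρ ∈ Δ with σ ⊆ ρ, (-1) ^ ρ.card := by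
  rw [Finset.sum_congr rfl fun (σ : Finset (Fin n)) _ =>
    Finset.sum_filter (fun ρ => σ ⊆ ρ) (fun ρ => (-1 : ℤ) ^ ρ.card), Finset.sum_comm]
  refine Finset.sum_congr rfl fun τ hτ => ?_
  rw [← Finset.sum_filter, Finset.sum_const, nsmul_eq_mul, mul_comm, ← Finset.card_powersetCard]
  congr 3
  ext σ
  simp only [Finset.mem_filter, Finset.mem_powersetCard]
  exact ⟨fun h => ⟨⟨hdown τ hτ σ h.1, h.2⟩, h.1⟩, fun h => ⟨h.2, h.1.2⟩⟩

theorem odd_dimensional_eulerian_implies_propertyE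
    (n d : ℕ) (Δ : Finset (Finset (Fin n)))
    (hempty : ∅ ∈ Δ)
    (hdown : ∀ σ ∈ Δ, ∀ τ ⊆ σ, τ ∈ Δ)
    (hd : 1 ≤ d)
    (heven : Even d)
    (hdim : ∀ σ ∈ Δ, σ.card ≤ d)
    (hmax : ∃ σ ∈ Δ, σ.card = d)
    (hpure : ∀ σ ∈ Δ, ∃ τ ∈ Δ, σ ⊆ τ ∧ τ.card = d)
    (heuler : ∀ σ ∈ Δ, σ ≠ ∅ →
      redEuler n (linkFace n Δ σ) = 1 + (Int.negOnePow ((d : ℤ) - 1 - σ.card) : ℤ)) :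
    ∀ k ≤ d, eVec n d Δ k = (-1) ^ (d - k) * (faceCount n Δ k : ℤ) := by
  have habove := sum_faces_above n d Δ hempty hdown heuler
  intro k hk
  have hsign : (-1 : ℤ) ^ (d - k) = (-1) ^ k * (-1) ^ d := by
    obtain ⟨m, rfl⟩ := Nat.exists_eq_add_of_le hk
    rw [Nat.add_sub_cancel_left, pow_add, ← mul_assoc, ← mul_pow]
    simp
  rw [eVec_eq_sum_faces n d Δ hdim, sum_card_choose n Δ hdown, hsign, mul_assoc]
  have hsum : ∀ σ ∈ Δ.filter (fun σ => σ.card = k),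
      ∑ ρ ∈ Δ with σ ⊆ ρ, (-1 : ℤ) ^ ρ.card = (-1) ^ d := by
    intro σ hσ
    rcases eq_or_ne σ ∅ with rfl | hne
    · simpa [heven.neg_one_pow] using sum_faces_eq_one n d Δ hempty hdown heven habove
    · exact habove σ (Finset.mem_filter.1 hσ).1 hne
  rw [Finset.sum_congr rfl hsum, Finset.sum_const, nsmul_eq_mul, faceCount,
    mul_comm ((-1 : ℤ) ^ d)]
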